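/- Let L ⊣ R be an adjunction with L : A ⥤ B and R : B ⥤ A, with unit η and counit ε, inducing the monad T = R∘L on A with multiplication R ε L and unit η. Let H be a monad on a category X, and fix a functor j : A ⥤ X. Then there is a bijection between: (i) the set of natural transformations φ with components φ_a : H(j a) ⟶ j(R(L a)) satisfying φ_a ∘ μ^H_{j a} = j(R(ε_{L a})) ∘ φ_{R(L a)} ∘ H(φ_a) and φ_a ∘ η^H_{j a} = j(η_a), and (ii) the set of functors k : B ⥤ X^H into the Eilenberg–Moore category of H satisfying U^H ∘ k = j ∘ R, where U^H is the forgetful functor. -/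

import Mathlib

open CategoryTheory

namespace CategoryTheory

/-- A left action of a monad `H` on a functor `F` with values in the base category of `H`. -/
structure Monad.LeftAction {B X : Type*} [Category B] [Category X] (H : Monad X) (F : B ⥤ X) where
  /-- The structure transformation of the action. -/
  act : F ⋙ (H : X ⥤ X) ⟶ F
  unit (b : B) : H.η.app (F.obj b) ≫ act.app b = 𝟙 (F.obj b)
  assoc (b : B) :
    H.μ.app (F.obj b) ≫ act.app b = (H : X ⥤ X).map (act.app b) ≫ act.app b

namespace Monad.LeftAction

variable {A B X : Type*} [Category A] [Category B] [Category X] {H : Monad X}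

@[ext]
theorem ext {F : B ⥤ X} {σ τ : H.LeftAction F} (h : ∀ b, σ.act.app b = τ.act.app b) : σ = τ := by
  obtain ⟨s, _, _⟩ := σ
  obtain ⟨t, _, _⟩ := τ
  obtain rfl : s = t := NatTrans.ext (funext h)
  rfl

theorem naturality {F : B ⥤ X} (σ : H.LeftAction F) {b b' : B} (f : b ⟶ b') :
    (H : X ⥤ X).map (F.map f) ≫ σ.act.app b' = σ.act.app b ≫ F.map f :=
  σ.act.naturality f

/-- The lift to the Eilenberg–Moore category of a functor with a left action. -/
def lift {F : B ⥤ X} (σ : H.LeftAction F) : B ⥤ H.Algebra where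
  obj b := { A := F.obj b, a := σ.act.app b, unit := σ.unit b, assoc := σ.assoc b }
  map f := { f := F.map f, h := σ.naturality f }
  map_id b := Monad.Algebra.Hom.ext (F.map_id b)
  map_comp f g := Monad.Algebra.Hom.ext (F.map_comp f g)

/-- The left action on the carrier of a functor to the Eilenberg–Moore category. -/
def ofFunctor (k : B ⥤ H.Algebra) : H.LeftAction (k ⋙ H.forget) where
  act := { app := fun b => (k.obj b).a, naturality := fun _ _ f => (k.map f).h }
  unit b := (k.obj b).unit
  assoc b := (k.obj b).assoc

theorem lift_injective {F : B ⥤ X} :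
    Function.Injective (lift : H.LeftAction F → (B ⥤ H.Algebra)) := by
  intro σ τ h
  ext b
  have hb : σ.lift.obj b = τ.lift.obj b := congrArg (fun k => k.obj b) h
  exact eq_of_heq (Monad.Algebra.mk.inj hb).2

/-- Left actions of `H` on `F` correspond to strict lifts of `F` to the Eilenberg–Moore
category. -/
noncomputable def equivLifts (H : Monad X) (F : B ⥤ X) :
    H.LeftAction F ≃ {k : B ⥤ H.Algebra // k ⋙ H.forget = F} :=
  Equiv.ofBijective (fun σ => ⟨σ.lift, rfl⟩)
    ⟨fun _ _ h => lift_injective (congrArg Subtype.val h), by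
      rintro ⟨k, rfl⟩
      exact ⟨ofFunctor k, rfl⟩⟩

variable {L : A ⥤ B} {R : B ⥤ A} (adj : L ⊣ R) {j : A ⥤ X}

/-- The left action on `R ⋙ j` induced by a monad morphism along `j` to the monad of `L ⊣ R`. -/
def ofMonadMorphism (φ : j ⋙ (H : X ⥤ X) ⟶ (L ⋙ R) ⋙ j)
    (hμ : ∀ a : A, H.μ.app (j.obj a) ≫ φ.app a =
      (H : X ⥤ X).map (φ.app a) ≫ φ.app (R.obj (L.obj a)) ≫
        j.map (R.map (adj.counit.app (L.obj a))))
    (hη : ∀ a : A, H.η.app (j.obj a) ≫ φ.app a = j.map (adj.unit.app a)) :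
    H.LeftAction (R ⋙ j) where
  act :=
    { app := fun b => φ.app (R.obj b) ≫ j.map (R.map (adj.counit.app b))
      naturality := fun b b' f => by
        have h := φ.naturality (R.map f)
        dsimp at h ⊢
        rw [reassoc_of% h, Category.assoc, ← j.map_comp, ← j.map_comp, ← R.map_comp,
          ← R.map_comp, adj.counit_naturality] }
  unit b := by
    dsimp
    rw [reassoc_of% (hη (R.obj b)), ← j.map_comp, adj.right_triangle_components, j.map_id]
  assoc b := by
    have h := φ.naturality (R.map (adj.counit.app b))
    dsimp at h ⊢
    rw [reassoc_of% (hμ (R.obj b)), Functor.map_comp, Category.assoc, reassoc_of% h,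
      ← j.map_comp, ← j.map_comp, ← R.map_comp, ← R.map_comp, adj.counit_naturality]

/-- The transformation `j ⋙ H ⟶ (L ⋙ R) ⋙ j` induced by a left action on `R ⋙ j`. -/
def toNatTrans (σ : H.LeftAction (R ⋙ j)) : j ⋙ (H : X ⥤ X) ⟶ (L ⋙ R) ⋙ j where
  app a := (H : X ⥤ X).map (j.map (adj.unit.app a)) ≫ σ.act.app (L.obj a)
  naturality a a' f := by
    have h := σ.naturality (L.map f)
    dsimp at h ⊢
    rw [Category.assoc, ← h, ← Functor.map_comp_assoc, ← Functor.map_comp_assoc,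
      ← j.map_comp, ← j.map_comp, adj.unit_naturality]

theorem map_unit_act_counit (σ : H.LeftAction (R ⋙ j)) (b : B) :
    (H : X ⥤ X).map (j.map (adj.unit.app (R.obj b))) ≫ σ.act.app (L.obj (R.obj b)) ≫
      j.map (R.map (adj.counit.app b)) = σ.act.app b := by
  have h := σ.naturality (adj.counit.app b)
  dsimp at h ⊢
  rw [← h, ← Functor.map_comp_assoc, ← j.map_comp, adj.right_triangle_components]
  exact (congrArg (· ≫ σ.act.app b) (by rw [j.map_id, Functor.map_id])).trans
    (Category.id_comp _)

theorem μ_toNatTrans (σ : H.LeftAction (R ⋙ j)) (a : A) :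
    H.μ.app (j.obj a) ≫ (toNatTrans adj σ).app a =
      (H : X ⥤ X).map ((toNatTrans adj σ).app a) ≫
        (toNatTrans adj σ).app (R.obj (L.obj a)) ≫
          j.map (R.map (adj.counit.app (L.obj a))) := by
  have hμ := H.μ.naturality (j.map (adj.unit.app a))
  have hσ := σ.assoc (L.obj a)
  have h := map_unit_act_counit adj σ (L.obj a)
  dsimp [toNatTrans] at h hμ hσ ⊢
  rw [← reassoc_of% hμ, hσ, Category.assoc, h, Functor.map_comp, Category.assoc]

theorem η_toNatTrans (σ : H.LeftAction (R ⋙ j)) (a : A) :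
    H.η.app (j.obj a) ≫ (toNatTrans adj σ).app a = j.map (adj.unit.app a) := by
  have hη := H.η.naturality (j.map (adj.unit.app a))
  have hσ := σ.unit (L.obj a)
  dsimp [toNatTrans] at hη hσ ⊢
  rw [← reassoc_of% hη, hσ, Category.comp_id]

/-- Monad morphisms along `j` from `H` to the monad of `L ⊣ R` correspond to left actions of `H`
on `R ⋙ j`. -/
def equivMonadMorphisms (H : Monad X) (j : A ⥤ X) :
    {φ : j ⋙ (H : X ⥤ X) ⟶ (L ⋙ R) ⋙ j //
      (∀ a : A, H.μ.app (j.obj a) ≫ φ.app a =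
        (H : X ⥤ X).map (φ.app a) ≫ φ.app (R.obj (L.obj a)) ≫
          j.map (R.map (adj.counit.app (L.obj a)))) ∧
      (∀ a : A, H.η.app (j.obj a) ≫ φ.app a = j.map (adj.unit.app a))} ≃
    H.LeftAction (R ⋙ j) where
  toFun φ := ofMonadMorphism adj φ.1 φ.2.1 φ.2.2
  invFun σ := ⟨toNatTrans adj σ, μ_toNatTrans adj σ, η_toNatTrans adj σ⟩
  left_inv := by
    rintro ⟨φ, hμ, hη⟩
    ext a
    have h := φ.naturality (adj.unit.app a)
    dsimp [toNatTrans, ofMonadMorphism] at h ⊢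
    rw [reassoc_of% h, ← j.map_comp, ← R.map_comp, adj.left_triangle_components, R.map_id,
      j.map_id, Category.comp_id]
  right_inv σ := by
    ext b
    exact (Category.assoc _ _ _).trans (map_unit_act_counit adj σ b)

end Monad.LeftAction

end CategoryTheory

/-- Let `L ⊣ R` be an adjunction inducing the monad `R ∘ L` on `A`, let `H`
be a monad on `X` and `j : A ⥤ X` a functor. Monad-morphism structures
`φ` (with components `φ_a : H (j a) ⟶ j (R (L a))` compatible with the multiplications and
units of `H` and of the induced monad) are in bijection with functors `k : B ⥤ X^H` into the
Eilenberg–Moore category of `H` satisfying `U^H ∘ k = j ∘ R`. -/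
theorem stmt6 {A : Type*} [Category A] {B : Type*} [Category B] {X : Type*} [Category X]
    (L : A ⥤ B) (R : B ⥤ A) (adj : L ⊣ R) (H : Monad X) (j : A ⥤ X) :
    Nonempty
      ({φ : j ⋙ (H : X ⥤ X) ⟶ (L ⋙ R) ⋙ j //
          (∀ a : A, H.μ.app (j.obj a) ≫ φ.app a =
            (H : X ⥤ X).map (φ.app a) ≫ φ.app (R.obj (L.obj a)) ≫
              j.map (R.map (adj.counit.app (L.obj a)))) ∧
          (∀ a : A, H.η.app (j.obj a) ≫ φ.app a = j.map (adj.unit.app a))} ≃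
        {k : B ⥤ H.Algebra // k ⋙ H.forget = R ⋙ j}) := by
  exact ⟨(Monad.LeftAction.equivMonadMorphisms adj H j).trans
    (Monad.LeftAction.equivLifts H (R ⋙ j))⟩
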